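/- Let N ≥ 2 and p ∈ (1, p_N), let u₀ be the unique solution of the Emden problem −Δu₀ = u₀^p in the unit ball B₁ ⊂ ℝ^N, u₀ > 0 in B₁, u₀ = 0 on ∂B₁, and set I_p = ∫_{B₁} u₀^p. Then a solution (α_λ, ψ_λ) of problem (P)_λ on the unit-volume ball 𝔻_N of radius R_N satisfies α_λ > 0 if and only if λ < I_p^{(p−1)/p} · R_N^{−(N/p)(1 − p/p_N)}; that is, λ_+(𝔻_N, p) = I_p^{1−1/p} R_N^{−(N/p)(1−p/p_N)}. -/

import Mathlib

open MeasureTheory Metric Set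

noncomputable section

/-- The Laplacian of a function on Euclidean space. -/
def lapl {N : ℕ} (f : EuclideanSpace ℝ (Fin N) → ℝ) (x : EuclideanSpace ℝ (Fin N)) : ℝ :=
  ∑ i : Fin N,
    fderiv ℝ (fun y => fderiv ℝ f y (EuclideanSpace.single i (1 : ℝ))) x
      (EuclideanSpace.single i (1 : ℝ))

/-- `(α, ψ)` is a solution of problem `(P)_λ` on `Ω`:
`ψ ∈ C²`, `-Δψ = (max (α + λψ) 0)^p` in `Ω`, `ψ = 0` on `∂Ω`, and
`∫_Ω (max (α + λψ) 0)^p = 1`. -/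
def IsSol {N : ℕ} (Ω : Set (EuclideanSpace ℝ (Fin N))) (p lam α : ℝ)
    (ψ : EuclideanSpace ℝ (Fin N) → ℝ) : Prop :=
  ContDiff ℝ 2 ψ ∧
  (∀ x ∈ Ω, -lapl ψ x = (max (α + lam * ψ x) 0) ^ p) ∧
  (∀ x ∈ frontier Ω, ψ x = 0) ∧
  (∫ x in Ω, (max (α + lam * ψ x) 0) ^ p) = 1

/-- The radius `R_N` of the ball in `ℝ^N` centered at the origin with unit volume. -/
def RN (N : ℕ) : ℝ :=
  (volume (ball (0 : EuclideanSpace ℝ (Fin N)) 1)).toReal ^ (-(1 : ℝ) / (N : ℝ))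

/-- `𝔻_N`: the open ball in `ℝ^N` centered at the origin with unit volume. -/
def DN (N : ℕ) : Set (EuclideanSpace ℝ (Fin N)) := ball 0 (RN N)

/-- `u` solves the Emden problem on `Ω`: `u ∈ C²`, `-Δu = u^p` and `u > 0` in `Ω`,
`u = 0` on `∂Ω`. -/
def IsEmden {N : ℕ} (Ω : Set (EuclideanSpace ℝ (Fin N))) (p : ℝ)
    (u : EuclideanSpace ℝ (Fin N) → ℝ) : Prop :=
  ContDiff ℝ 2 u ∧ (∀ x ∈ Ω, -lapl u x = u x ^ p) ∧ (∀ x ∈ Ω, 0 < u x) ∧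
  ∀ x ∈ frontier Ω, u x = 0

open scoped RealInnerProductSpace Topology

/-! ### The Laplacian of `C²` functions -/

section Laplacian

variable {N : ℕ} {f g : EuclideanSpace ℝ (Fin N) → ℝ}

lemma lapl_eq_sum (hf : ContDiff ℝ 2 f) (x : EuclideanSpace ℝ (Fin N)) :
    lapl f x = ∑ i : Fin N, fderiv ℝ (fderiv ℝ f) x (EuclideanSpace.single i (1 : ℝ))
      (EuclideanSpace.single i (1 : ℝ)) := by
  unfold lapl
  refine Finset.sum_congr rfl fun i _ => ?_
  have h : DifferentiableAt ℝ (fderiv ℝ f) x :=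
    (hf.fderiv_right (m := 1) (by norm_num)).differentiable (by norm_num) x
  rw [fderiv_clm_apply h (by fun_prop)]
  simp

lemma lapl_eq_sum_orthonormalBasis {ι : Type*} [Fintype ι] (hf : ContDiff ℝ 2 f)
    (b : OrthonormalBasis ι ℝ (EuclideanSpace ℝ (Fin N))) (x : EuclideanSpace ℝ (Fin N)) :
    lapl f x = ∑ i, fderiv ℝ (fderiv ℝ f) x (b i) (b i) := by
  have h1 := congrFun (InnerProductSpace.laplacian_eq_iteratedFDeriv_orthonormalBasis f b) x
  have h2 := congrFun (InnerProductSpace.laplacian_eq_iteratedFDeriv_orthonormalBasis f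
    (EuclideanSpace.basisFun (Fin N) ℝ)) x
  rw [lapl_eq_sum hf]
  simp only [iteratedFDeriv_two_apply] at h1 h2
  rw [h1] at h2
  simpa using h2.symm

lemma fderiv_fderiv_comp_affine (hf : ContDiff ℝ 2 f)
    (L : EuclideanSpace ℝ (Fin N) →L[ℝ] EuclideanSpace ℝ (Fin N))
    (a x v : EuclideanSpace ℝ (Fin N)) :
    fderiv ℝ (fderiv ℝ fun y => f (L y + a)) x v v =
      fderiv ℝ (fderiv ℝ f) (L x + a) (L v) (L v) := by
  have hA : ∀ y, HasFDerivAt (fun y => L y + a) L y := fun y => L.hasFDerivAt.add_const a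
  have h1 : (fderiv ℝ fun y => f (L y + a)) = fun y => (fderiv ℝ f (L y + a)).comp L := by
    ext1 y
    exact ((hf.differentiable (by norm_num) _).hasFDerivAt.comp y (hA y)).fderiv
  have h2 : HasFDerivAt (fun y => fderiv ℝ f (L y + a))
      ((fderiv ℝ (fderiv ℝ f) (L x + a)).comp L) x :=
    ((hf.fderiv_right (m := 1) (by norm_num)).differentiable
      (by norm_num) _).hasFDerivAt.comp x (hA x)
  rw [h1, (h2.clm_comp (hasFDerivAt_const L x)).fderiv]
  simp

lemma lapl_comp_isometry (hf : ContDiff ℝ 2 f)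
    (L : EuclideanSpace ℝ (Fin N) ≃ₗᵢ[ℝ] EuclideanSpace ℝ (Fin N))
    (a x : EuclideanSpace ℝ (Fin N)) :
    lapl (fun y => f (L y + a)) x = lapl f (L x + a) := by
  have hc : ContDiff ℝ 2 fun y => f (L y + a) := hf.comp (by fun_prop)
  rw [lapl_eq_sum hc,
    lapl_eq_sum_orthonormalBasis hf ((EuclideanSpace.basisFun (Fin N) ℝ).map L)]
  refine Finset.sum_congr rfl fun i _ => ?_
  have := fderiv_fderiv_comp_affine hf (L : _ →L[ℝ] _) a x (EuclideanSpace.single i (1 : ℝ))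
  simpa using this

lemma lapl_comp_smul (hf : ContDiff ℝ 2 f) (b : ℝ) (x : EuclideanSpace ℝ (Fin N)) :
    lapl (fun y => f (b • y)) x = b ^ 2 * lapl f (b • x) := by
  have hc : ContDiff ℝ 2 fun y => f (b • y) := hf.comp (by fun_prop)
  rw [lapl_eq_sum hc, lapl_eq_sum hf, Finset.mul_sum]
  refine Finset.sum_congr rfl fun i _ => ?_
  have := fderiv_fderiv_comp_affine hf (b • ContinuousLinearMap.id ℝ _) 0 x
    (EuclideanSpace.single i (1 : ℝ))
  simp only [smul_apply, ContinuousLinearMap.id_apply, add_zero, map_smul,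
    smul_eq_mul] at this
  rw [this]
  ring

lemma lapl_add (hf : ContDiff ℝ 2 f) (hg : ContDiff ℝ 2 g) (x : EuclideanSpace ℝ (Fin N)) :
    lapl (fun y => f y + g y) x = lapl f x + lapl g x := by
  have h1 : (fderiv ℝ fun y => f y + g y) = fun y => fderiv ℝ f y + fderiv ℝ g y := by
    ext1 y
    exact fderiv_add (hf.differentiable (by norm_num) y) (hg.differentiable (by norm_num) y)
  have h2 := fderiv_fun_add (x := x)
    ((hf.fderiv_right (m := 1) (by norm_num)).differentiable (by norm_num) x)
    ((hg.fderiv_right (m := 1) (by norm_num)).differentiable (by norm_num) x)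
  rw [lapl_eq_sum (hf.add hg), lapl_eq_sum hf, lapl_eq_sum hg, ← Finset.sum_add_distrib, h1, h2]
  simp

lemma lapl_const_mul (hf : ContDiff ℝ 2 f) (c : ℝ) (x : EuclideanSpace ℝ (Fin N)) :
    lapl (fun y => c * f y) x = c * lapl f x := by
  have h1 : (fderiv ℝ fun y => c * f y) = fun y => c • fderiv ℝ f y := by
    ext1 y
    exact fderiv_const_mul (hf.differentiable (by norm_num) y) c
  have h2 := fderiv_fun_const_smul (x := x)
    ((hf.fderiv_right (m := 1) (by norm_num)).differentiable (by norm_num) x) c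
  rw [lapl_eq_sum (contDiff_const.mul hf), lapl_eq_sum hf, Finset.mul_sum, h1, h2]
  simp

lemma lapl_const (c : ℝ) (x : EuclideanSpace ℝ (Fin N)) :
    lapl (fun _ : EuclideanSpace ℝ (Fin N) => c) x = 0 := by
  simp [lapl]

lemma lapl_sub (hf : ContDiff ℝ 2 f) (hg : ContDiff ℝ 2 g) (x : EuclideanSpace ℝ (Fin N)) :
    lapl (fun y => f y - g y) x = lapl f x - lapl g x := by
  have h := lapl_add hf (contDiff_const.mul hg : ContDiff ℝ 2 fun y => (-1 : ℝ) * g y) x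
  rw [lapl_const_mul hg] at h
  simpa [sub_eq_add_neg] using h

lemma contDiff_exp_normSq (a : ℝ) (y : EuclideanSpace ℝ (Fin N)) :
    ContDiff ℝ 2 fun x : EuclideanSpace ℝ (Fin N) => Real.exp (a * ‖x - y‖ ^ 2) :=
  Real.contDiff_exp.comp (contDiff_const.mul ((contDiff_id.sub contDiff_const).norm_sq ℝ))

lemma hasFDerivAt_exp_normSq (a : ℝ) (y x : EuclideanSpace ℝ (Fin N)) :
    HasFDerivAt (fun x : EuclideanSpace ℝ (Fin N) => Real.exp (a * ‖x - y‖ ^ 2))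
      ((2 * a * Real.exp (a * ‖x - y‖ ^ 2)) • innerSL ℝ (x - y)) x := by
  have h := (((hasFDerivAt_id x).sub_const y).norm_sq.const_mul a).exp
  refine h.congr_fderiv ?_
  ext v
  simp
  ring

lemma lapl_exp_normSq (a : ℝ) (y x : EuclideanSpace ℝ (Fin N)) :
    lapl (fun x => Real.exp (a * ‖x - y‖ ^ 2)) x =
      (4 * a ^ 2 * ‖x - y‖ ^ 2 + 2 * N * a) * Real.exp (a * ‖x - y‖ ^ 2) := by
  unfold lapl
  have key : ∀ e : EuclideanSpace ℝ (Fin N), ‖e‖ = 1 →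
      fderiv ℝ (fun z => fderiv ℝ (fun x => Real.exp (a * ‖x - y‖ ^ 2)) z e) x e =
        (4 * a ^ 2 * ⟪e, x - y⟫ ^ 2 + 2 * a) * Real.exp (a * ‖x - y‖ ^ 2) := by
    intro e he
    have h1 : (fun z => fderiv ℝ (fun x => Real.exp (a * ‖x - y‖ ^ 2)) z e) =
        fun z => (2 * a * Real.exp (a * ‖z - y‖ ^ 2)) * innerSL ℝ e (z - y) := by
      ext1 z
      rw [(hasFDerivAt_exp_normSq a y z).fderiv]
      simp [inner_sub_right, real_inner_comm e]
    have h2 := ((hasFDerivAt_exp_normSq a y x).const_mul (2 * a)).mul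
      ((innerSL ℝ e).hasFDerivAt.comp x ((hasFDerivAt_id x).sub_const y))
    rw [h1]
    erw [h2.fderiv]
    simp [he, inner_sub_right, real_inner_comm e]
    ring
  rw [Finset.sum_congr rfl fun i _ => key (EuclideanSpace.single i 1) (by simp),
    ← Finset.sum_mul, Finset.sum_add_distrib, ← Finset.mul_sum]
  congr 2
  · have := (EuclideanSpace.basisFun (Fin N) ℝ).sum_sq_norm_inner_right (x - y)
    simp only [EuclideanSpace.basisFun_apply, Real.norm_eq_abs, sq_abs] at this
    rw [this]
  · simp
    ring

end Laplacian

/-! ### Maximum principles -/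

section MaximumPrinciple

variable {N : ℕ} {v : EuclideanSpace ℝ (Fin N) → ℝ}

lemma fderiv_fderiv_nonneg_of_isLocalMin (hv : ContDiff ℝ 2 v) {x : EuclideanSpace ℝ (Fin N)}
    (hx : IsLocalMin v x) (e : EuclideanSpace ℝ (Fin N)) :
    0 ≤ fderiv ℝ (fderiv ℝ v) x e e := by
  by_contra! hneg
  set g : ℝ → ℝ := fun t => v (x + t • e) with hg
  have hl : ∀ t : ℝ, HasDerivAt (fun t : ℝ => x + t • e) e t := fun t => by
    simpa using ((hasDerivAt_id t).smul_const e).const_add x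
  have hg1 : ∀ t, HasDerivAt g (fderiv ℝ v (x + t • e) e) t := fun t =>
    (hv.differentiable (by norm_num) _).hasFDerivAt.comp_hasDerivAt t (hl t)
  have hd1 : deriv g = fun t => fderiv ℝ v (x + t • e) e := funext fun t => (hg1 t).deriv
  have hd2 : deriv (deriv g) 0 = fderiv ℝ (fderiv ℝ v) x e e := by
    have h2 : DifferentiableAt ℝ (fderiv ℝ v) (x + (0 : ℝ) • e) :=
      (hv.fderiv_right (m := 1) (by norm_num)).differentiable (by norm_num) _
    have h3 : HasDerivAt (fun t : ℝ => fderiv ℝ v (x + t • e))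
        (fderiv ℝ (fderiv ℝ v) (x + (0 : ℝ) • e) e) 0 :=
      HasFDerivAt.comp_hasDerivAt (0 : ℝ) h2.hasFDerivAt (hl 0)
    have h4 := ((ContinuousLinearMap.apply ℝ ℝ e).hasFDerivAt).comp_hasDerivAt (0 : ℝ) h3
    rw [hd1]
    simpa [Function.comp_def] using h4.deriv
  have hmin : IsLocalMin g 0 := by
    have hc : Filter.Tendsto (fun t : ℝ => x + t • e) (𝓝 0) (𝓝 x) := by
      simpa using (hl 0).continuousAt.tendsto
    filter_upwards [hc.eventually hx] with t ht
    simpa [hg] using ht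
  have hmax : IsLocalMax g 0 := isLocalMax_of_deriv_deriv_neg (by rw [hd2]; exact hneg)
    hmin.deriv_eq_zero (hg1 0).continuousAt
  have hconst : g =ᶠ[𝓝 0] fun _ => g 0 := by
    filter_upwards [hmin, hmax] with t h1 h2 using le_antisymm h2 h1
  have : deriv (deriv g) 0 = 0 := by
    rw [hconst.deriv.deriv_eq]
    simp
  rw [hd2] at this
  exact hneg.ne this

lemma lapl_nonneg_of_isLocalMin (hv : ContDiff ℝ 2 v) {x : EuclideanSpace ℝ (Fin N)}
    (hx : IsLocalMin v x) : 0 ≤ lapl v x := by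
  rw [lapl_eq_sum hv]
  exact Finset.sum_nonneg fun i _ => fderiv_fderiv_nonneg_of_isLocalMin hv hx _

/-- The weak minimum principle for superharmonic functions on a compact set. -/
lemma le_of_lapl_nonpos (hN : 0 < N) (hv : ContDiff ℝ 2 v)
    {K : Set (EuclideanSpace ℝ (Fin N))} (hK : IsCompact K) {m : ℝ}
    (h : ∀ x ∈ K, m ≤ v x ∨ (K ∈ 𝓝 x ∧ lapl v x ≤ 0)) {x : EuclideanSpace ℝ (Fin N)}
    (hx : x ∈ K) : m ≤ v x := by
  by_contra! hlt
  set Φ : EuclideanSpace ℝ (Fin N) → ℝ := fun x => Real.exp (1 * ‖x - 0‖ ^ 2) with hΦ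
  have hΦc : ContDiff ℝ 2 Φ := contDiff_exp_normSq 1 0
  obtain ⟨z, hzK, hz⟩ := hK.exists_isMaxOn ⟨x, hx⟩ hΦc.continuous.continuousOn
  have hΦpos : ∀ y, 0 < Φ y := fun y => Real.exp_pos _
  set ε := (m - v x) / Φ z with hε
  have hεpos : 0 < ε := div_pos (by linarith) (hΦpos z)
  have hw : ContDiff ℝ 2 fun y => v y - ε * Φ y := hv.sub (contDiff_const.mul hΦc)
  obtain ⟨y, hyK, hy⟩ := hK.exists_isMinOn ⟨x, hx⟩ hw.continuous.continuousOn
  have hyx : v y - ε * Φ y ≤ v x - ε * Φ x := hy hx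
  have h1 : ε * Φ y ≤ m - v x := by
    have h2 : Φ y ≤ Φ z := hz hyK
    have h3 : ε * Φ z = m - v x := by rw [hε]; field_simp [(hΦpos z).ne']
    rw [← h3]
    gcongr
  have hym : v y < m := by nlinarith [mul_pos hεpos (hΦpos x)]
  rcases h y hyK with h2 | ⟨hnhds, hlap⟩
  · linarith
  · have h3 := lapl_nonneg_of_isLocalMin hw (hy.isLocalMin hnhds)
    rw [lapl_sub hv (contDiff_const.mul hΦc), lapl_const_mul hΦc, hΦ, lapl_exp_normSq] at h3
    have hN' : (0 : ℝ) < N := by exact_mod_cast hN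
    have : 0 < ε * ((4 * 1 ^ 2 * ‖y - 0‖ ^ 2 + 2 * N * 1) * Real.exp (1 * ‖y - 0‖ ^ 2)) := by
      positivity
    linarith

/-- The barrier estimate behind the Hopf lemma. -/
lemma exists_barrier_le (hv : ContDiff ℝ 2 v) {y : EuclideanSpace ℝ (Fin N)}
    {r : ℝ} (hr : 0 < r) (hN : 0 < N) (hlap : ∀ x ∈ ball y r, lapl v x ≤ 0)
    (hnn : ∀ x ∈ closedBall y r, 0 ≤ v x) (hy : 0 < v y) :
    ∃ ε > 0, ∃ a > 0, ∃ ρ ∈ Ioo 0 r, (∀ x ∈ closedBall y ρ, 0 < v x) ∧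
      ∀ x ∈ closedBall y r, ρ ≤ dist x y →
        ε * (Real.exp (-a * ‖x - y‖ ^ 2) - Real.exp (-a * r ^ 2)) ≤ v x := by
  obtain ⟨ρ', hρ', hball⟩ := Metric.eventually_nhds_iff_ball.1
    (hv.continuous.continuousAt.eventually_const_lt hy)
  obtain ⟨ρ, hρ0, hρlt⟩ := exists_between (lt_min hr hρ')
  have hρr : ρ < r := hρlt.trans_le (min_le_left _ _)
  have hpos : ∀ x ∈ closedBall y ρ, 0 < v x := fun x hx =>
    hball x (closedBall_subset_ball (hρlt.trans_le (min_le_right _ _)) hx)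
  obtain ⟨z, hzK, hz⟩ := (isCompact_closedBall y ρ).exists_isMinOn
    ⟨y, mem_closedBall_self hρ0.le⟩ hv.continuous.continuousOn
  have hN' : (0 : ℝ) < N := by exact_mod_cast hN
  set a : ℝ := N / (2 * ρ ^ 2) with ha
  have ha0 : 0 < a := by positivity
  have haρ : 2 * a * ρ ^ 2 = N := by rw [ha]; field_simp
  refine ⟨v z, hpos z hzK, a, ha0, ρ, ⟨hρ0, hρr⟩, hpos, fun x hx hxρ => ?_⟩
  set Φ : EuclideanSpace ℝ (Fin N) → ℝ := fun x => Real.exp (-a * ‖x - y‖ ^ 2) with hΦ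
  have hΦc : ContDiff ℝ 2 Φ := contDiff_exp_normSq (-a) y
  have hw : ContDiff ℝ 2 fun x => v x - v z * Φ x := hv.sub (contDiff_const.mul hΦc)
  have hK : IsCompact (closedBall y r \ ball y ρ) := (isCompact_closedBall y r).diff isOpen_ball
  have key := le_of_lapl_nonpos hN hw hK (m := -(v z * Real.exp (-a * r ^ 2))) (x := x) ?_
    ⟨hx, by simpa using hxρ⟩
  · simp only [hΦ] at key
    linarith
  · rintro x ⟨hx1, hx2⟩
    rw [mem_closedBall] at hx1
    rw [mem_ball, not_lt] at hx2
    rcases hx1.eq_or_lt with h1 | h1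
    · left
      have : Φ x = Real.exp (-a * r ^ 2) := by
        simp only [hΦ]
        rw [← dist_eq_norm, h1]
      rw [this]
      linarith [hnn x (by simp [h1])]
    rcases hx2.eq_or_lt with h2 | h2
    · left
      have h3 : v z ≤ v x := hz (mem_closedBall.2 h2.ge)
      have h4 : Φ x ≤ 1 := by
        rw [hΦ, Real.exp_le_one_iff]
        nlinarith [sq_nonneg ‖x - y‖]
      nlinarith [hpos z hzK, Real.exp_pos (-a * r ^ 2)]
    · right
      constructor
      · rw [sdiff_eq]
        refine Filter.inter_mem (closedBall_mem_nhds_of_mem h1) ?_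
        exact Filter.mem_of_superset ((isClosed_closedBall (x := y)
          (ε := ρ)).isOpen_compl.mem_nhds (by simpa using h2))
          (compl_subset_compl.2 ball_subset_closedBall)
      · rw [lapl_sub hv (contDiff_const.mul hΦc), lapl_const_mul hΦc, hΦ, lapl_exp_normSq]
        have h5 : ρ ^ 2 ≤ ‖x - y‖ ^ 2 := by
          rw [← dist_eq_norm]
          gcongr
        have h6 : 0 ≤ 4 * (-a) ^ 2 * ‖x - y‖ ^ 2 + 2 * N * (-a) := by
          have : 0 ≤ 4 * a ^ 2 * (‖x - y‖ ^ 2 - ρ ^ 2) := by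
            have := sub_nonneg.2 h5
            positivity
          rw [← haρ]
          nlinarith
        have h7 := mul_nonneg (hpos z hzK).le (mul_nonneg h6 (Real.exp_pos (-a * ‖x - y‖ ^ 2)).le)
        linarith [hlap x h1]

lemma pos_on_ball_of_lapl_nonpos (hN : 0 < N) (hv : ContDiff ℝ 2 v)
    {y : EuclideanSpace ℝ (Fin N)} {r : ℝ} (hlap : ∀ x ∈ ball y r, lapl v x ≤ 0)
    (hnn : ∀ x ∈ closedBall y r, 0 ≤ v x) (hy : 0 < v y) :
    ∀ x ∈ ball y r, 0 < v x := by
  intro x hx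
  obtain ⟨ε, hε, a, ha, ρ, hρ, h1, h2⟩ :=
    exists_barrier_le hv (pos_of_mem_ball hx) hN hlap hnn hy
  rcases le_total (dist x y) ρ with h | h
  · exact h1 x h
  · refine lt_of_lt_of_le (mul_pos hε ?_) (h2 x (ball_subset_closedBall hx) h)
    rw [sub_pos, Real.exp_lt_exp, ← dist_eq_norm]
    have : dist x y ^ 2 < r ^ 2 := by
      gcongr
      exact hx
    nlinarith

/-- The Hopf boundary point lemma. -/
lemma fderiv_pos_of_lapl_nonpos (hN : 0 < N) (hv : ContDiff ℝ 2 v)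
    {y : EuclideanSpace ℝ (Fin N)} {r : ℝ} (hr : 0 < r)
    (hlap : ∀ x ∈ ball y r, lapl v x ≤ 0) (hnn : ∀ x ∈ closedBall y r, 0 ≤ v x)
    (hy : 0 < v y) {x e : EuclideanSpace ℝ (Fin N)} (hx : dist x y = r) (hvx : v x = 0)
    (he : 0 < ⟪e, y - x⟫) : 0 < fderiv ℝ v x e := by
  obtain ⟨ε, hε, a, ha, ρ, hρ, -, h2⟩ := exists_barrier_le hv hr hN hlap hnn hy
  set q : ℝ → ℝ := fun t =>
    v (x + t • e) - ε * (Real.exp (-a * ‖x + t • e - y‖ ^ 2) - Real.exp (-a * r ^ 2)) with hq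
  have hl : HasDerivAt (fun t : ℝ => x + t • e) e 0 := by
    simpa using ((hasDerivAt_id (0 : ℝ)).smul_const e).const_add x
  have hv0 : HasDerivAt (fun t : ℝ => v (x + t • e)) (fderiv ℝ v x e) 0 := by
    have h0 : HasFDerivAt v (fderiv ℝ v x) (x + (0 : ℝ) • e) := by
      simpa using (hv.differentiable (by norm_num) x).hasFDerivAt
    exact h0.comp_hasDerivAt 0 hl
  have hΦ0 : HasDerivAt (fun t : ℝ => Real.exp (-a * ‖x + t • e - y‖ ^ 2))
      (2 * a * Real.exp (-a * r ^ 2) * ⟪e, y - x⟫) 0 := by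
    have h0 := hasFDerivAt_exp_normSq (-a) y (x + (0 : ℝ) • e)
    have h3 := h0.comp_hasDerivAt (0 : ℝ) hl
    have hn : ‖x - y‖ = r := by rw [← dist_eq_norm, hx]
    refine h3.congr_deriv ?_
    simp [hn, inner_sub_right, real_inner_comm e]
    ring
  have hq0 : HasDerivAt q
      (fderiv ℝ v x e - ε * (2 * a * Real.exp (-a * r ^ 2) * ⟪e, y - x⟫)) 0 := by
    have := hv0.sub ((hΦ0.sub_const (Real.exp (-a * r ^ 2))).const_mul ε)
    exact this
  have hcont : ContinuousAt (fun t : ℝ => dist (x + t • e) y) 0 := by fun_prop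
  have hev1 : ∀ᶠ t : ℝ in 𝓝[>] 0, ρ ≤ dist (x + t • e) y := by
    have : ρ < dist (x + (0 : ℝ) • e) y := by simpa [hx] using hρ.2
    exact (hcont.eventually_const_lt this).filter_mono nhdsWithin_le_nhds |>.mono
      fun t ht => ht.le
  have hev2 : ∀ᶠ t : ℝ in 𝓝[>] 0, x + t • e ∈ closedBall y r := by
    have hc : ContinuousAt (fun t : ℝ => t * ‖e‖ ^ 2 - 2 * ⟪e, y - x⟫) 0 := by fun_prop
    have h3 : (fun t : ℝ => t * ‖e‖ ^ 2 - 2 * ⟪e, y - x⟫) 0 < 0 := by simpa using he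
    filter_upwards [(hc.eventually_lt_const h3).filter_mono nhdsWithin_le_nhds,
      self_mem_nhdsWithin] with t ht ht0
    rw [mem_closedBall, dist_eq_norm]
    have hn : ‖x - y‖ = r := by rw [← dist_eq_norm, hx]
    refine abs_le_of_sq_le_sq' ?_ hr.le |>.2
    have h4 : x + t • e - y = (x - y) + t • e := by abel
    have h5 : ⟪x - y, t • e⟫ = -(t * ⟪e, y - x⟫) := by
      rw [inner_smul_right, real_inner_comm, ← neg_sub y x, inner_neg_right]
      ring
    rw [h4, norm_add_sq_real, h5, norm_smul, hn, mul_pow, Real.norm_eq_abs, sq_abs]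
    have : t * (t * ‖e‖ ^ 2 - 2 * ⟪e, y - x⟫) ≤ 0 :=
      mul_nonpos_of_nonneg_of_nonpos (le_of_lt ht0) ht.le
    nlinarith
  have hqnn : ∀ᶠ t : ℝ in 𝓝[>] 0, 0 ≤ slope q 0 t := by
    filter_upwards [hev1, hev2, self_mem_nhdsWithin] with t h3 h4 h5
    have hq0 : q 0 = 0 := by
      have hn : ‖x - y‖ = r := by rw [← dist_eq_norm, hx]
      simp [hq, hvx, hn]
    rw [slope_def_field, hq0]
    have : 0 ≤ q t := sub_nonneg.2 (h2 _ h4 h3)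
    have h5' : (0 : ℝ) < t := h5
    simp only [sub_zero]
    positivity
  have h6 := ge_of_tendsto (hasDerivWithinAt_iff_tendsto_slope' (by simp)|>.1
    (hq0.hasDerivWithinAt (s := Ioi 0))) hqnn
  have : 0 < ε * (2 * a * Real.exp (-a * r ^ 2) * ⟪e, y - x⟫) := by positivity
  linarith

/-- The strong minimum principle for superharmonic functions. -/
lemma pos_of_isPreconnected (hN : 0 < N) (hv : ContDiff ℝ 2 v)
    {Ω : Set (EuclideanSpace ℝ (Fin N))} (hΩ : IsOpen Ω) (hc : IsPreconnected Ω)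
    (hlap : ∀ x ∈ Ω, lapl v x ≤ 0) (hnn : ∀ x ∈ Ω, 0 ≤ v x)
    {z : EuclideanSpace ℝ (Fin N)} (hz : z ∈ Ω) (hvz : 0 < v z) : ∀ x ∈ Ω, 0 < v x := by
  have hu : IsOpen {x | 0 < v x} := isOpen_lt continuous_const hv.continuous
  refine hc.subset_of_closure_inter_subset hu ⟨z, hz, hvz⟩ ?_
  rintro x ⟨hx1, hx2⟩
  obtain ⟨d, hd, hball⟩ := Metric.isOpen_iff.1 hΩ x hx2
  obtain ⟨y, hy, hxy⟩ := Metric.mem_closure_iff.1 hx1 (d / 2) (half_pos hd)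
  have hsub : closedBall y (d / 2) ⊆ Ω := fun w hw => hball (by
    rw [mem_closedBall] at hw
    rw [mem_ball]
    have := dist_triangle w y x
    rw [dist_comm y x] at this
    linarith)
  exact pos_on_ball_of_lapl_nonpos hN hv (fun w hw => hlap w (hsub (ball_subset_closedBall hw)))
    (fun w hw => hnn w (hsub hw)) hy x hxy

end MaximumPrinciple

/-! ### Radial symmetry by moving planes -/

section MovingPlanes

variable {N : ℕ} {u : EuclideanSpace ℝ (Fin N) → ℝ} {f : ℝ → ℝ} {R : ℝ}
  {e : EuclideanSpace ℝ (Fin N)}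

lemma exists_linearIsometryEquiv_eq_reflection (he : ‖e‖ = 1) :
    ∃ L : EuclideanSpace ℝ (Fin N) ≃ₗᵢ[ℝ] EuclideanSpace ℝ (Fin N),
      ∀ x, L x = x - (2 * ⟪e, x⟫) • e := by
  refine ⟨(ℝ ∙ e)ᗮ.reflection, fun x => ?_⟩
  rw [Submodule.reflection_orthogonal_apply, Submodule.reflection_singleton_apply, he]
  simp [mul_smul, two_smul]

lemma norm_sq_reflect (he : ‖e‖ = 1) (l : ℝ) (x : EuclideanSpace ℝ (Fin N)) :
    ‖x - (2 * (⟪e, x⟫ - l)) • e‖ ^ 2 = ‖x‖ ^ 2 - 4 * l * (⟪e, x⟫ - l) := by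
  rw [norm_sub_sq_real, inner_smul_right, norm_smul, he, real_inner_comm, mul_one,
    Real.norm_eq_abs, sq_abs]
  ring

lemma norm_reflect_le (he : ‖e‖ = 1) {l : ℝ} (hl : 0 ≤ l) {x : EuclideanSpace ℝ (Fin N)}
    (hx : l ≤ ⟪e, x⟫) : ‖x - (2 * (⟪e, x⟫ - l)) • e‖ ≤ ‖x‖ := by
  refine abs_le_of_sq_le_sq' ?_ (norm_nonneg _) |>.2
  rw [norm_sq_reflect he]
  nlinarith [mul_nonneg hl (sub_nonneg.2 hx)]

lemma norm_reflect_lt (he : ‖e‖ = 1) {l : ℝ} (hl : 0 < l) {x : EuclideanSpace ℝ (Fin N)}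
    (hx : l < ⟪e, x⟫) : ‖x - (2 * (⟪e, x⟫ - l)) • e‖ < ‖x‖ := by
  refine abs_lt_of_sq_lt_sq' ?_ (norm_nonneg _) |>.2
  rw [norm_sq_reflect he]
  nlinarith [mul_pos hl (sub_pos.2 hx)]

lemma nonneg_on_closedBall (hbd : ∀ x, ‖x‖ = R → u x = 0)
    (hpos : ∀ x ∈ ball (0 : EuclideanSpace ℝ (Fin N)) R, 0 < u x) :
    ∀ x ∈ closedBall (0 : EuclideanSpace ℝ (Fin N)) R, 0 ≤ u x := by
  intro x hx
  rw [mem_closedBall_zero_iff] at hx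
  rcases hx.eq_or_lt with h | h
  · exact (hbd x h).ge
  · exact (hpos x (by simpa using h)).le

lemma lapl_reflect_sub_nonpos (hu : ContDiff ℝ 2 u) (hf : Monotone f)
    (hlap : ∀ x ∈ ball (0 : EuclideanSpace ℝ (Fin N)) R, -lapl u x = f (u x)) (he : ‖e‖ = 1)
    {l : ℝ} (hl : 0 ≤ l) {x : EuclideanSpace ℝ (Fin N)} (hx : ‖x‖ < R) (hxl : l ≤ ⟪e, x⟫)
    (hle : u x ≤ u (x - (2 * (⟪e, x⟫ - l)) • e)) :
    lapl (fun y => u (y - (2 * (⟪e, y⟫ - l)) • e) - u y) x ≤ 0 := by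
  obtain ⟨L, hL⟩ := exists_linearIsometryEquiv_eq_reflection he
  have hA : ∀ y, y - (2 * (⟪e, y⟫ - l)) • e = L y + (2 * l) • e := by
    intro y
    rw [hL]
    module
  simp only [hA] at hle ⊢
  have hc : ContDiff ℝ 2 fun y => u (L y + (2 * l) • e) := hu.comp (by fun_prop)
  rw [lapl_sub hc hu, lapl_comp_isometry hu]
  have h1 := hlap x (by simpa using hx)
  have h2 := hlap (L x + (2 * l) • e) (by
    rw [← hA, mem_ball_zero_iff]
    exact (norm_reflect_le he hl hxl).trans_lt hx)
  linarith [hf hle]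

lemma reflect_sub_pos (hN : 0 < N) (hu : ContDiff ℝ 2 u) (hf : Monotone f)
    (hlap : ∀ x ∈ ball (0 : EuclideanSpace ℝ (Fin N)) R, -lapl u x = f (u x))
    (hpos : ∀ x ∈ ball (0 : EuclideanSpace ℝ (Fin N)) R, 0 < u x)
    (hbd : ∀ x, ‖x‖ = R → u x = 0) (he : ‖e‖ = 1) {l : ℝ} (hl : 0 < l)
    (hgood : ∀ x, ‖x‖ ≤ R → l ≤ ⟪e, x⟫ → u x ≤ u (x - (2 * (⟪e, x⟫ - l)) • e))
    {x : EuclideanSpace ℝ (Fin N)} (hx : ‖x‖ ≤ R) (hxl : l < ⟪e, x⟫) :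
    u x < u (x - (2 * (⟪e, x⟫ - l)) • e) := by
  have hsphere : ∀ y, ‖y‖ = R → l < ⟪e, y⟫ → u y < u (y - (2 * (⟪e, y⟫ - l)) • e) := by
    intro y hy hyl
    rw [hbd y hy]
    exact hpos _ (by rw [mem_ball_zero_iff, ← hy]; exact norm_reflect_lt he hl hyl)
  rcases hx.eq_or_lt with hxR | hxR
  · exact hsphere x hxR hxl
  have hlR : l < R := by
    have := real_inner_le_norm e x
    rw [he, one_mul] at this
    linarith
  set w : EuclideanSpace ℝ (Fin N) → ℝ := fun y => u (y - (2 * (⟪e, y⟫ - l)) • e) - u y with hw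
  have hwc : ContDiff ℝ 2 w := by
    refine (hu.comp (contDiff_id.sub ?_)).sub hu
    exact (contDiff_const.mul ((contDiff_const.inner ℝ contDiff_id).sub contDiff_const)).smul
      contDiff_const
  set Ω : Set (EuclideanSpace ℝ (Fin N)) := ball 0 R ∩ {y | l < ⟪e, y⟫} with hΩ
  have hopen : IsOpen Ω := isOpen_ball.inter (isOpen_lt continuous_const (by fun_prop))
  have hconv : Convex ℝ Ω := (convex_ball _ _).inter
    (convex_halfSpace_gt (f := fun y => ⟪e, y⟫) (innerSL ℝ e).toLinearMap.isLinear l)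
  have hee : ∀ t : ℝ, ⟪e, t • e⟫ = t := fun t => by
    rw [inner_smul_right, real_inner_self_eq_norm_sq, he]
    ring
  obtain ⟨z, hzΩ, hz⟩ : ∃ z ∈ Ω, 0 < w z := by
    have hR0 : 0 < R := hl.trans hlR
    have h0 : 0 < w (R • e) := sub_pos.2 (hsphere _ (by
      rw [norm_smul, he, mul_one, Real.norm_of_nonneg hR0.le]) (by rwa [hee]))
    have hc : ContinuousAt (fun t : ℝ => w (t • e)) R :=
      (hwc.continuous.comp (by fun_prop)).continuousAt
    have h1 := (hc.eventually_const_lt h0).filter_mono (nhdsWithin_le_nhds (s := Iio R))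
    obtain ⟨t, ht, htl⟩ := (h1.and (Ioo_mem_nhdsLT hlR)).exists
    refine ⟨t • e, ⟨?_, ?_⟩, ht⟩
    · rw [mem_ball_zero_iff, norm_smul, he, mul_one, Real.norm_of_nonneg (hl.trans htl.1).le]
      exact htl.2
    · rw [mem_ofPred_eq, hee]
      exact htl.1
  have := pos_of_isPreconnected hN hwc hopen hconv.isPreconnected
    (fun y hy => lapl_reflect_sub_nonpos hu hf hlap he hl.le (by simpa using hy.1) (le_of_lt hy.2)
      (hgood y (mem_ball_zero_iff.1 hy.1).le (le_of_lt hy.2)))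
    (fun y hy => sub_nonneg.2 (hgood y (mem_ball_zero_iff.1 hy.1).le (le_of_lt hy.2))) hzΩ hz x
    ⟨by simpa using hxR, hxl⟩
  exact sub_pos.1 this

lemma fderiv_neg_of_mem_plane (hN : 0 < N) (hu : ContDiff ℝ 2 u) (hf : Monotone f)
    (hf0 : ∀ t, 0 ≤ f t)
    (hlap : ∀ x ∈ ball (0 : EuclideanSpace ℝ (Fin N)) R, -lapl u x = f (u x))
    (hpos : ∀ x ∈ ball (0 : EuclideanSpace ℝ (Fin N)) R, 0 < u x)
    (hbd : ∀ x, ‖x‖ = R → u x = 0) (he : ‖e‖ = 1) {l : ℝ} (hl : 0 < l)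
    (hgood : ∀ x, ‖x‖ ≤ R → l ≤ ⟪e, x⟫ → u x ≤ u (x - (2 * (⟪e, x⟫ - l)) • e))
    {x : EuclideanSpace ℝ (Fin N)} (hx : ‖x‖ ≤ R) (hxl : ⟪e, x⟫ = l) :
    fderiv ℝ u x e < 0 := by
  have hx0 : 0 < ‖x‖ := by
    have := real_inner_le_norm e x
    rw [he, one_mul] at this
    linarith
  have hR : 0 < R := hx0.trans_le hx
  rcases hx.eq_or_lt with hxR | hxR
  · have := fderiv_pos_of_lapl_nonpos hN hu hR (y := 0)
      (fun y hy => by linarith [hlap y hy, hf0 (u y)]) (nonneg_on_closedBall hbd hpos)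
      (hpos 0 (by simpa using hR)) (x := x) (e := -e) (by simpa using hxR) (hbd x hxR)
      (by simpa [hxl] using hl)
    simpa using this
  set w : EuclideanSpace ℝ (Fin N) → ℝ := fun y => u (y - (2 * (⟪e, y⟫ - l)) • e) - u y with hw
  have hwc : ContDiff ℝ 2 w := by
    refine (hu.comp (contDiff_id.sub ?_)).sub hu
    exact (contDiff_const.mul ((contDiff_const.inner ℝ contDiff_id).sub contDiff_const)).smul
      contDiff_const
  obtain ⟨L, hL⟩ := exists_linearIsometryEquiv_eq_reflection he
  have hA : ∀ y, y - (2 * (⟪e, y⟫ - l)) • e = L y + (2 * l) • e := by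
    intro y
    rw [hL]
    module
  have hee : ⟪e, e⟫ = (1 : ℝ) := by rw [real_inner_self_eq_norm_sq, he, one_pow]
  have hfd : fderiv ℝ w x e = -2 * fderiv ℝ u x e := by
    have hAx : L x + (2 * l) • e = x := by
      rw [← hA, hxl]
      simp
    have h1 : HasFDerivAt (fun y => L y + (2 * l) • e)
        (L : EuclideanSpace ℝ (Fin N) →L[ℝ] EuclideanSpace ℝ (Fin N)) x :=
      (L : EuclideanSpace ℝ (Fin N) →L[ℝ] EuclideanSpace ℝ (Fin N)).hasFDerivAt.add_const _
    have h2 : HasFDerivAt u (fderiv ℝ u x) (L x + (2 * l) • e) := by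
      rw [hAx]
      exact (hu.differentiable (by norm_num) x).hasFDerivAt
    have h3 := (h2.comp x h1).sub (hu.differentiable (by norm_num) x).hasFDerivAt
    have h4 : w = (u ∘ fun y => L y + (2 * l) • e) - u := by
      ext y
      simp [hw, hA]
    have hLe : L e = -e := by
      rw [hL, hee]
      module
    rw [h4, h3.fderiv]
    simp [hLe]
    ring
  set ρ : ℝ := (R - ‖x‖) / 4 with hρ
  have hρ0 : 0 < ρ := by rw [hρ]; linarith
  have hin : ∀ y ∈ closedBall (x + ρ • e) ρ, ‖y‖ < R := by
    intro y hy
    rw [mem_closedBall_iff_norm] at hy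
    have h1 : ‖y‖ ≤ ‖y - (x + ρ • e)‖ + (‖x‖ + ‖ρ • e‖) :=
      calc ‖y‖ = ‖(y - (x + ρ • e)) + (x + ρ • e)‖ := by rw [sub_add_cancel]
        _ ≤ _ := (norm_add_le _ _).trans (by gcongr; exact norm_add_le _ _)
    rw [norm_smul, he, Real.norm_of_nonneg hρ0.le] at h1
    linarith
  have hin2 : ∀ y ∈ closedBall (x + ρ • e) ρ, l ≤ ⟪e, y⟫ := by
    intro y hy
    rw [mem_closedBall_iff_norm] at hy
    have h1 := (abs_le.1 (abs_real_inner_le_norm e (y - (x + ρ • e)))).1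
    rw [inner_sub_right, inner_add_right, inner_smul_right, hxl, hee, he] at h1
    linarith
  have hy0 : 0 < w (x + ρ • e) := by
    refine sub_pos.2 (reflect_sub_pos hN hu hf hlap hpos hbd he hl hgood
      (hin _ (mem_closedBall_self hρ0.le)).le ?_)
    rw [inner_add_right, inner_smul_right, hxl, hee]
    linarith
  have := fderiv_pos_of_lapl_nonpos hN hwc hρ0 (y := x + ρ • e)
    (fun y hy => lapl_reflect_sub_nonpos hu hf hlap he hl.le
      (hin y (ball_subset_closedBall hy)) (hin2 y (ball_subset_closedBall hy))
      (hgood y (hin y (ball_subset_closedBall hy)).le (hin2 y (ball_subset_closedBall hy))))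
    (fun y hy => sub_nonneg.2 (hgood y (hin y hy).le (hin2 y hy))) hy0 (x := x) (e := e)
    (by rw [dist_eq_norm]; simp [norm_smul, he, abs_of_pos hρ0])
    (by simp [hw, hxl]) (by simp [inner_smul_right, he, hρ0])
  rw [hfd] at this
  linarith

/-- Near a plane point where `u` decreases in direction `e`, the reflected value is larger. -/
lemma eventually_le_reflect (hu : ContDiff ℝ 2 u) {l : ℝ} {x : EuclideanSpace ℝ (Fin N)}
    (hxl : ⟪e, x⟫ = l) (hd : fderiv ℝ u x e < 0) :
    ∀ᶠ z : ℝ × EuclideanSpace ℝ (Fin N) in 𝓝 (l, x),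
      z.1 ≤ ⟪e, z.2⟫ → u z.2 ≤ u (z.2 - (2 * (⟪e, z.2⟫ - z.1)) • e) := by
  have hcd : Continuous fun y => fderiv ℝ u y e :=
    (hu.continuous_fderiv (by norm_num)).clm_apply continuous_const
  obtain ⟨δ, hδ, hball⟩ := Metric.eventually_nhds_iff_ball.1
    (hcd.continuousAt.eventually_lt_const hd)
  have h1 : ∀ᶠ z : ℝ × EuclideanSpace ℝ (Fin N) in 𝓝 (l, x), z.2 ∈ ball x δ :=
    continuous_snd.continuousAt.eventually (isOpen_ball.mem_nhds (mem_ball_self hδ))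
  have h2 : ∀ᶠ z : ℝ × EuclideanSpace ℝ (Fin N) in 𝓝 (l, x),
      z.2 - (2 * (⟪e, z.2⟫ - z.1)) • e ∈ ball x δ := by
    have hc : Continuous fun z : ℝ × EuclideanSpace ℝ (Fin N) =>
      z.2 - (2 * (⟪e, z.2⟫ - z.1)) • e := by fun_prop
    refine hc.continuousAt.eventually (isOpen_ball.mem_nhds ?_)
    simpa [hxl] using hδ
  filter_upwards [h1, h2] with z hz1 hz2 hz
  set c := 2 * (⟪e, z.2⟫ - z.1) with hc
  have hc0 : 0 ≤ c := by linarith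
  set g : ℝ → ℝ := fun t => u (z.2 - t • (c • e)) with hg
  have hgd : ∀ t, HasDerivAt g (-(c * fderiv ℝ u (z.2 - t • (c • e)) e)) t := by
    intro t
    have h3 : HasDerivAt (fun t : ℝ => z.2 - t • (c • e)) (-(c • e)) t := by
      simpa using ((hasDerivAt_id t).smul_const (c • e)).const_sub z.2
    have := (hu.differentiable (by norm_num) _).hasFDerivAt.comp_hasDerivAt t h3
    refine this.congr_deriv ?_
    simp
  have hmono : MonotoneOn g (Icc 0 1) := by
    refine monotoneOn_of_deriv_nonneg (convex_Icc 0 1)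
      (fun t _ => (hgd t).continuousAt.continuousWithinAt)
      (fun t _ => (hgd t).differentiableAt.differentiableWithinAt) fun t ht => ?_
    rw [interior_Icc] at ht
    rw [(hgd t).deriv]
    have hmem : z.2 - t • (c • e) ∈ ball x δ := by
      have := (convex_ball x δ) hz1 hz2 (by linarith [ht.2] : 0 ≤ 1 - t) ht.1.le (by ring)
      convert this using 1
      module
    have := hball _ hmem
    nlinarith
  have := hmono (left_mem_Icc.2 zero_le_one) (right_mem_Icc.2 zero_le_one) zero_le_one
  simpa [hg] using this

lemma le_reflect (hN : 0 < N) (hR : 0 < R) (hu : ContDiff ℝ 2 u) (hf : Monotone f)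
    (hf0 : ∀ t, 0 ≤ f t)
    (hlap : ∀ x ∈ ball (0 : EuclideanSpace ℝ (Fin N)) R, -lapl u x = f (u x))
    (hpos : ∀ x ∈ ball (0 : EuclideanSpace ℝ (Fin N)) R, 0 < u x)
    (hbd : ∀ x, ‖x‖ = R → u x = 0) (he : ‖e‖ = 1)
    {x : EuclideanSpace ℝ (Fin N)} (hx : ‖x‖ ≤ R) (hxl : 0 ≤ ⟪e, x⟫) :
    u x ≤ u (x - (2 * ⟪e, x⟫) • e) := by
  set s : Set ℝ := {l | ∀ x, ‖x‖ ≤ R → l ≤ ⟪e, x⟫ →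
    u x ≤ u (x - (2 * (⟪e, x⟫ - l)) • e)} with hs
  suffices h : Icc 0 R ⊆ s by simpa using h ⟨le_rfl, hR.le⟩ x hx hxl
  have hcont : ∀ x, Continuous fun l : ℝ => u (x - (2 * (⟪e, x⟫ - l)) • e) :=
    fun x => hu.continuous.comp (by fun_prop)
  have hclosed : IsClosed s := by
    refine isClosed_of_closure_subset fun l hl x hx hxl => ?_
    rcases hxl.eq_or_lt with h | h
    · simp [← h]
    · have hfr := mem_closure_iff_frequently.1 hl
      have hev : ∀ᶠ l' in 𝓝 l, l' < ⟪e, x⟫ := eventually_lt_nhds h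
      refine ge_of_tendsto_of_frequently (hcont x).continuousAt.tendsto ?_
      exact (hfr.and_eventually hev).mono fun l' hl' => hl'.1 x hx hl'.2.le
  refine (hclosed.inter isClosed_Icc).Icc_subset_of_forall_exists_lt ?_ ?_
  · intro x hx hxl
    have h1 := real_inner_le_norm e x
    rw [he, one_mul] at h1
    have : ⟪e, x⟫ = R := by linarith
    simp [this]
  · rintro l ⟨hl, hl0, hlR⟩ m hm
    have hev : ∀ᶠ l' in 𝓝 l, ∀ x ∈ closedBall (0 : EuclideanSpace ℝ (Fin N)) R,
        l' ≤ ⟪e, x⟫ → u x ≤ u (x - (2 * (⟪e, x⟫ - l')) • e) := by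
      refine (isCompact_closedBall _ _).eventually_forall_of_forall_eventually fun x hx => ?_
      rw [mem_closedBall_zero_iff] at hx
      have hci : Continuous fun z : ℝ × EuclideanSpace ℝ (Fin N) => ⟪e, z.2⟫ - z.1 := by fun_prop
      rcases lt_trichotomy ⟪e, x⟫ l with h | h | h
      · filter_upwards [hci.continuousAt.eventually_lt_const
          (show (fun z : ℝ × EuclideanSpace ℝ (Fin N) => ⟪e, z.2⟫ - z.1) (l, x) < 0 by
            simpa using h)] with z hz hz'
        linarith
      · exact eventually_le_reflect hu h
          (fderiv_neg_of_mem_plane hN hu hf hf0 hlap hpos hbd he hl0 hl hx h)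
      · have h1 := reflect_sub_pos hN hu hf hlap hpos hbd he hl0 hl hx h
        have hc : Continuous fun z : ℝ × EuclideanSpace ℝ (Fin N) =>
            u (z.2 - (2 * (⟪e, z.2⟫ - z.1)) • e) - u z.2 := by
          have := hu.continuous
          fun_prop
        filter_upwards [hc.continuousAt.eventually_const_lt
          (show 0 < (fun z : ℝ × EuclideanSpace ℝ (Fin N) =>
            u (z.2 - (2 * (⟪e, z.2⟫ - z.1)) • e) - u z.2) (l, x) by simpa using h1)] with z hz _
        linarith
    obtain ⟨l', h1, h2⟩ := ((hev.filter_mono (nhdsWithin_le_nhds (s := Iio l))).and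
      (Ico_mem_nhdsLT hm)).exists
    exact ⟨l', fun x hx => h1 x (by simpa using hx), h2⟩

/-- Gidas–Ni–Nirenberg: positive solutions on a ball are radial. -/
lemma radial_of_pos (hN : 0 < N) (hR : 0 < R) (hu : ContDiff ℝ 2 u) (hf : Monotone f)
    (hf0 : ∀ t, 0 ≤ f t)
    (hlap : ∀ x ∈ ball (0 : EuclideanSpace ℝ (Fin N)) R, -lapl u x = f (u x))
    (hpos : ∀ x ∈ ball (0 : EuclideanSpace ℝ (Fin N)) R, 0 < u x)
    (hbd : ∀ x, ‖x‖ = R → u x = 0)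
    {x y : EuclideanSpace ℝ (Fin N)} (hx : ‖x‖ ≤ R) (hxy : ‖x‖ = ‖y‖) : u x = u y := by
  have key : ∀ x y : EuclideanSpace ℝ (Fin N), ‖x‖ ≤ R → ‖x‖ = ‖y‖ → u x ≤ u y := by
    intro x y hx hxy
    rcases eq_or_ne x y with rfl | hne
    · rfl
    have hd : 0 < ‖x - y‖ := norm_pos_iff.2 (sub_ne_zero.2 hne)
    set e := ‖x - y‖⁻¹ • (x - y) with he
    have he1 : ‖e‖ = 1 := by
      rw [he, norm_smul, norm_inv, norm_norm, inv_mul_cancel₀ hd.ne']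
    have h1 : ⟪x - y, x⟫ = ‖x - y‖ ^ 2 / 2 := by
      rw [norm_sub_sq_real, inner_sub_left, real_inner_self_eq_norm_sq, ← hxy, real_inner_comm]
      ring
    have h2 : ⟪e, x⟫ = ‖x - y‖ / 2 := by
      rw [he, inner_smul_left, h1]
      simp
      field_simp
    have h3 := le_reflect hN hR hu hf hf0 hlap hpos hbd he1 hx (by rw [h2]; positivity)
    have h4 : x - (2 * ⟪e, x⟫) • e = y := by
      rw [h2, he, smul_smul]
      field_simp
      module
    rwa [h4] at h3
  exact le_antisymm (key x y hx hxy) (key y x (hxy ▸ hx) hxy.symm)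

end MovingPlanes

/-! ### Uniqueness of radial solutions -/

section Uniqueness

variable {N : ℕ} {d : EuclideanSpace ℝ (Fin N) → ℝ} {ρ : ℝ}

lemma le_exp_of_lapl_le (hN : 0 < N) (hd : ContDiff ℝ 2 d) {a κ : ℝ} (hκ : 0 ≤ κ)
    (hrad : ∀ x y, ‖x‖ ≤ ρ → ‖x‖ = ‖y‖ → d x = d y)
    (hlap : ∀ x ∈ ball (0 : EuclideanSpace ℝ (Fin N)) ρ,
      lapl d x ≤ κ * (2 * N * a) * Real.exp (a * ‖x - 0‖ ^ 2))
    (h0 : d 0 = 0) {x : EuclideanSpace ℝ (Fin N)} (hx : ‖x‖ ≤ ρ) :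
    d x ≤ κ * (Real.exp (a * ‖x - 0‖ ^ 2) - 1) := by
  set Φ : EuclideanSpace ℝ (Fin N) → ℝ := fun x => Real.exp (a * ‖x - 0‖ ^ 2) with hΦ
  have hΦc : ContDiff ℝ 2 Φ := contDiff_exp_normSq a 0
  have hw : ContDiff ℝ 2 fun y => d y - κ * Φ y := hd.sub (contDiff_const.mul hΦc)
  have key := le_of_lapl_nonpos hN hw (isCompact_closedBall 0 ‖x‖) (m := d x - κ * Φ x) (x := 0) ?_
    (by simp)
  · have : Φ 0 = 1 := by simp [hΦ]
    rw [h0, this] at key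
    linarith
  · intro y hy
    rw [mem_closedBall_zero_iff] at hy
    rcases hy.eq_or_lt with h | h
    · left
      have h1 : Φ x = Φ y := by simp [hΦ, h]
      rw [h1, hrad x y hx h.symm]
    · right
      refine ⟨closedBall_mem_nhds_of_mem (by simpa using h), ?_⟩
      rw [lapl_sub hd (contDiff_const.mul hΦc), lapl_const_mul hΦc, hΦ, lapl_exp_normSq]
      have h1 := hlap y (by simpa using h.trans_le hx)
      have h2 : 0 ≤ κ * (4 * a ^ 2 * ‖y - 0‖ ^ 2) * Real.exp (a * ‖y - 0‖ ^ 2) := by positivity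
      linarith

lemma eq_zero_of_abs_lapl_le (hN : 0 < N) (hd : ContDiff ℝ 2 d) {L : ℝ} (hL : 0 < L)
    (hrad : ∀ x y, ‖x‖ ≤ ρ → ‖x‖ = ‖y‖ → d x = d y)
    (hlap : ∀ x ∈ ball (0 : EuclideanSpace ℝ (Fin N)) ρ, |lapl d x| ≤ L * |d x|)
    (h0 : d 0 = 0) {x : EuclideanSpace ℝ (Fin N)} (hx : ‖x‖ ≤ ρ) : d x = 0 := by
  set Φ : EuclideanSpace ℝ (Fin N) → ℝ := fun x => Real.exp (L * ‖x - 0‖ ^ 2) with hΦ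
  have hΦc : ContDiff ℝ 2 Φ := contDiff_exp_normSq L 0
  have hΦpos : ∀ y, 0 < Φ y := fun y => Real.exp_pos _
  obtain ⟨z, hzK, hz⟩ := (isCompact_closedBall (0 : EuclideanSpace ℝ (Fin N)) ρ).exists_isMaxOn
    ⟨x, by simpa using hx⟩ (f := fun y => |d y| / Φ y)
    (hd.continuous.abs.div hΦc.continuous fun y => (hΦpos y).ne').continuousOn
  rw [mem_closedBall_zero_iff] at hzK
  set S := |d z| / Φ z with hS
  have hS0 : 0 ≤ S := div_nonneg (abs_nonneg _) (hΦpos z).le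
  have hle : ∀ y, ‖y‖ ≤ ρ → |d y| ≤ S * Φ y := fun y hy =>
    (div_le_iff₀ (hΦpos y)).1 (hz (by simpa using hy))
  have hN' : (1 : ℝ) ≤ N := by exact_mod_cast hN
  have hκ : S / (2 * N) * (2 * N * L) = L * S := by field_simp
  have hbound : ∀ y ∈ ball (0 : EuclideanSpace ℝ (Fin N)) ρ,
      |lapl d y| ≤ S / (2 * N) * (2 * N * L) * Real.exp (L * ‖y - 0‖ ^ 2) := by
    intro y hy
    rw [hκ, mul_assoc]
    exact (hlap y hy).trans (by gcongr; exact hle y (mem_ball_zero_iff.1 hy).le)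
  have h1 := le_exp_of_lapl_le hN hd (by positivity) hrad
    (fun y hy => (le_abs_self _).trans (hbound y hy)) h0 hzK
  have hneg : ContDiff ℝ 2 fun y => (-1 : ℝ) * d y := contDiff_const.mul hd
  have h2 := le_exp_of_lapl_le (a := L) (κ := S / (2 * N)) hN hneg (by positivity)
    (fun x y hx hxy => by rw [hrad x y hx hxy])
    (fun y hy => by
      rw [lapl_const_mul hd]
      linarith [neg_abs_le (lapl d y), hbound y hy]) (by simp [h0]) hzK
  have h3 : |d z| ≤ S / (2 * N) * (Φ z - 1) := abs_le'.2 ⟨h1, by linarith⟩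
  have h4 : |d z| = S * Φ z := by rw [hS, div_mul_cancel₀ _ (hΦpos z).ne']
  have h5 : S / (2 * N) ≤ S / 2 := by
    gcongr
    linarith
  have h6 : S * Φ z ≤ S / 2 * Φ z := by
    rw [← h4]
    refine h3.trans ?_
    have : S / (2 * N) * Φ z ≤ S / 2 * Φ z := by
      have := (hΦpos z).le
      gcongr
    have : 0 ≤ S / (2 * N) := by positivity
    linarith
  have h7 : S = 0 := by nlinarith [hΦpos z]
  have := hle x hx
  rw [h7, zero_mul] at this
  exact abs_nonpos_iff.1 this

lemma abs_max_rpow_sub_le {p : ℝ} (hp : 1 < p) {C s t : ℝ} (hs : |s| ≤ C) (ht : |t| ≤ C) :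
    |(max s 0) ^ p - (max t 0) ^ p| ≤ p * C ^ (p - 1) * |s - t| := by
  have hC : 0 ≤ C := (abs_nonneg s).trans hs
  have hmem : ∀ r, |r| ≤ C → max r 0 ∈ Icc 0 C := fun r hr =>
    ⟨le_max_right _ _, max_le ((le_abs_self r).trans hr) hC⟩
  have h := (convex_Icc (0 : ℝ) C).norm_image_sub_le_of_norm_hasDerivWithin_le
    (f := fun x : ℝ => x ^ p) (f' := fun x => p * x ^ (p - 1)) (C := p * C ^ (p - 1))
    (fun x _ => (Real.hasDerivAt_rpow_const (Or.inr hp.le)).hasDerivWithinAt)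
    (fun x hx => by
      have := hx.1
      rw [Real.norm_of_nonneg (by positivity)]
      gcongr
      exact hx.2) (hmem t ht) (hmem s hs)
  refine h.trans ?_
  rw [Real.norm_eq_abs]
  exact mul_le_mul_of_nonneg_left (abs_max_sub_max_le_abs s t 0) (by positivity)

lemma eq_of_radial_solutions (hN : 0 < N) {p lam : ℝ} (hp : 1 < p) (hlam : 0 < lam)
    {z₁ z₂ : EuclideanSpace ℝ (Fin N) → ℝ} (h₁ : ContDiff ℝ 2 z₁) (h₂ : ContDiff ℝ 2 z₂)
    (hrad₁ : ∀ x y, ‖x‖ ≤ ρ → ‖x‖ = ‖y‖ → z₁ x = z₁ y)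
    (hrad₂ : ∀ x y, ‖x‖ ≤ ρ → ‖x‖ = ‖y‖ → z₂ x = z₂ y)
    (hlap₁ : ∀ x ∈ ball (0 : EuclideanSpace ℝ (Fin N)) ρ, -lapl z₁ x = lam * (max (z₁ x) 0) ^ p)
    (hlap₂ : ∀ x ∈ ball (0 : EuclideanSpace ℝ (Fin N)) ρ, -lapl z₂ x = lam * (max (z₂ x) 0) ^ p)
    (h0 : z₁ 0 = z₂ 0) {x : EuclideanSpace ℝ (Fin N)} (hx : ‖x‖ ≤ ρ) : z₁ x = z₂ x := by
  obtain ⟨C₁, hC₁⟩ :=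
    (isCompact_closedBall (0 : EuclideanSpace ℝ (Fin N)) ρ).exists_bound_of_continuousOn
      h₁.continuous.continuousOn
  obtain ⟨C₂, hC₂⟩ :=
    (isCompact_closedBall (0 : EuclideanSpace ℝ (Fin N)) ρ).exists_bound_of_continuousOn
      h₂.continuous.continuousOn
  set C := max C₁ C₂ with hC
  have hC0 : 0 ≤ C := (norm_nonneg _).trans ((hC₁ x (by simpa using hx)).trans (le_max_left _ _))
  have hL : 0 < lam * (p * C ^ (p - 1)) + 1 := by positivity
  have := eq_zero_of_abs_lapl_le hN (h₁.sub h₂) hL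
    (fun x y hx hxy => by simp only [hrad₁ x y hx hxy, hrad₂ x y hx hxy]) (fun y hy => ?_)
    (sub_eq_zero.2 h0) hx
  · exact sub_eq_zero.1 this
  · have hy' := ball_subset_closedBall hy
    have h3 := abs_max_rpow_sub_le hp ((hC₁ y hy').trans (le_max_left _ _) : |z₁ y| ≤ C)
      ((hC₂ y hy').trans (le_max_right _ _) : |z₂ y| ≤ C)
    have h4 : lapl (fun y => z₁ y - z₂ y) y =
        -(lam * ((max (z₁ y) 0) ^ p - (max (z₂ y) 0) ^ p)) := by
      rw [lapl_sub h₁ h₂]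
      linarith [hlap₁ y hy, hlap₂ y hy]
    rw [h4, abs_neg, abs_mul, abs_of_pos hlam]
    have h5 := mul_le_mul_of_nonneg_left h3 hlam.le
    linarith [abs_nonneg (z₁ y - z₂ y)]

end Uniqueness

/-! ### The threshold -/

section Threshold

variable {N : ℕ}

lemma rpow_mul_rpow_neg_rpow {n p lam b c : ℝ} (hn : 0 < n) (hp : 1 < p) (hb : 0 < b) (hc : 0 < c)
    (hbc : b ^ 2 = lam * c ^ (p - 1)) :
    (b ^ n * c ^ (-p)) ^ ((p - 1) / p) =
      lam * b ^ (-(n / p) * (1 - p * (n - 2) / n)) := by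
  have hp0 : 0 < p := by linarith
  have hE : -(n / p) * (1 - p * (n - 2) / n) = n * ((p - 1) / p) - (2 : ℕ) := by
    push_cast
    field_simp
    ring
  have hq : -p * ((p - 1) / p) = -(p - 1) := by field_simp
  rw [Real.mul_rpow (by positivity) (by positivity), ← Real.rpow_mul hb.le, ← Real.rpow_mul hc.le,
    hE, hq, Real.rpow_sub_natCast hb.ne', hbc, Real.rpow_neg hc.le]
  have h1 : c ^ (p - 1) ≠ 0 := by positivity
  have h2 : lam ≠ 0 := by
    rintro rfl
    simp [hb.ne'] at hbc
  field_simp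

lemma exponent_neg (hN : 2 ≤ N) {p : ℝ} (hp : 1 < p)
    (hpN : N = 2 ∨ p < (N : ℝ) / ((N : ℝ) - 2)) :
    -((N : ℝ) / p) * (1 - p * ((N : ℝ) - 2) / (N : ℝ)) < 0 := by
  have hN' : (2 : ℝ) ≤ N := by exact_mod_cast hN
  have h : p * ((N : ℝ) - 2) < N := by
    rcases hpN with h | h
    · subst h
      norm_num
    · rcases hN'.eq_or_lt with h2 | h2
      · rw [← h2]
        norm_num
      · rwa [lt_div_iff₀ (by linarith)] at h
  have h1 : p * ((N : ℝ) - 2) / N < 1 := by rwa [div_lt_one (by linarith)]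
  have h2 : 0 < (N : ℝ) / p := by positivity
  nlinarith

lemma RN_pos : 0 < RN N :=
  Real.rpow_pos_of_pos (ENNReal.toReal_pos (measure_ball_pos _ _ one_pos).ne'
    measure_ball_lt_top.ne) _

lemma integrableOn_ball_rpow {v : EuclideanSpace ℝ (Fin N) → ℝ} (hv : Continuous v) {p : ℝ}
    (hp : 0 ≤ p) (r : ℝ) : IntegrableOn (fun x => v x ^ p) (ball 0 r) :=
  ((hv.rpow_const fun _ => Or.inr hp).continuousOn.integrableOn_compact
    (isCompact_closedBall 0 r)).mono_set ball_subset_closedBall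

lemma monotone_max_rpow {p : ℝ} (hp : 0 ≤ p) : Monotone fun t : ℝ => (max t 0) ^ p :=
  fun _ _ hst => Real.rpow_le_rpow (le_max_right _ _) (max_le_max_right 0 hst) hp

open scoped Pointwise in
lemma setIntegral_ball_scale {u : EuclideanSpace ℝ (Fin N) → ℝ} {p b c : ℝ}
    (hb : 0 < b) (hc : 0 < c)
    (hu : ∀ x ∈ ball (0 : EuclideanSpace ℝ (Fin N)) 1, 0 < u x) :
    ∫ x in ball (0 : EuclideanSpace ℝ (Fin N)) 1, u x ^ p =
      b ^ (N : ℝ) * c ^ (-p) *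
        ∫ x in ball (0 : EuclideanSpace ℝ (Fin N)) b⁻¹, (c * u (b • x)) ^ p := by
  have h := Measure.setIntegral_comp_smul_of_pos volume (fun x => u x ^ p)
    (ball (0 : EuclideanSpace ℝ (Fin N)) b⁻¹) hb
  have hs : b • ball (0 : EuclideanSpace ℝ (Fin N)) b⁻¹ = ball 0 1 := by
    rw [_root_.smul_ball hb.ne', smul_zero, Real.norm_of_nonneg hb.le, mul_inv_cancel₀ hb.ne']
  rw [hs, finrank_euclideanSpace_fin, smul_eq_mul] at h
  have h2 : ∫ x in ball (0 : EuclideanSpace ℝ (Fin N)) b⁻¹, (c * u (b • x)) ^ p =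
      c ^ p * ∫ x in ball (0 : EuclideanSpace ℝ (Fin N)) b⁻¹, u (b • x) ^ p := by
    rw [← integral_const_mul]
    refine setIntegral_congr_fun measurableSet_ball fun x hx => ?_
    have : b • x ∈ ball (0 : EuclideanSpace ℝ (Fin N)) 1 := hs ▸ smul_mem_smul_set hx
    exact Real.mul_rpow hc.le (hu _ this).le
  rw [h2, h, Real.rpow_neg hc.le, Real.rpow_natCast]
  have : c ^ p ≠ 0 := by positivity
  field_simp

lemma IsEmden.integral_pos {u : EuclideanSpace ℝ (Fin N) → ℝ} {p : ℝ} (hp : 0 ≤ p)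
    (hu : IsEmden (ball (0 : EuclideanSpace ℝ (Fin N)) 1) p u) :
    0 < ∫ x in ball (0 : EuclideanSpace ℝ (Fin N)) 1, u x ^ p := by
  have hpos : ∀ x ∈ ball (0 : EuclideanSpace ℝ (Fin N)) 1, 0 < u x ^ p := fun x hx =>
    Real.rpow_pos_of_pos (hu.2.2.1 x hx) p
  rw [setIntegral_pos_iff_support_of_nonneg_ae
    ((ae_restrict_iff' measurableSet_ball).2 (.of_forall fun x hx => (hpos x hx).le))
    (integrableOn_ball_rpow hu.1.continuous hp 1)]
  refine (measure_ball_pos volume (0 : EuclideanSpace ℝ (Fin N)) one_pos).trans_le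
    (measure_mono fun x hx => ⟨(hpos x hx).ne', hx⟩)

lemma IsEmden.radial (hN : 0 < N) {u : EuclideanSpace ℝ (Fin N) → ℝ} {p : ℝ} (hp : 0 ≤ p)
    (hu : IsEmden (ball (0 : EuclideanSpace ℝ (Fin N)) 1) p u)
    (x y : EuclideanSpace ℝ (Fin N)) (hx : ‖x‖ ≤ 1) (hxy : ‖x‖ = ‖y‖) : u x = u y := by
  obtain ⟨hc, hlap, hpos, hbd⟩ := hu
  refine radial_of_pos hN one_pos hc (monotone_max_rpow hp)
    (fun t => Real.rpow_nonneg (le_max_right _ _) _) (fun x hx => ?_) hpos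
    (fun x hx => hbd x (by simpa [frontier_ball (0 : EuclideanSpace ℝ (Fin N)) one_ne_zero]
      using hx)) hx hxy
  rw [hlap x hx, max_eq_left (hpos x hx).le]

variable {p lam α R : ℝ} {ψ : EuclideanSpace ℝ (Fin N) → ℝ}

lemma IsSol.eq_zero_of_norm_eq (hR : 0 < R)
    (h : IsSol (ball (0 : EuclideanSpace ℝ (Fin N)) R) p lam α ψ)
    (x : EuclideanSpace ℝ (Fin N)) (hx : ‖x‖ = R) : ψ x = 0 :=
  h.2.2.1 x (by simpa [frontier_ball (0 : EuclideanSpace ℝ (Fin N)) hR.ne'] using hx)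

lemma IsSol.exists_pos (hp : 0 < p)
    (h : IsSol (ball (0 : EuclideanSpace ℝ (Fin N)) R) p lam α ψ) :
    ∃ x ∈ ball (0 : EuclideanSpace ℝ (Fin N)) R, 0 < α + lam * ψ x := by
  by_contra! hcon
  have h1 := h.2.2.2
  rw [setIntegral_congr_fun (g := fun _ => (0 : ℝ)) measurableSet_ball fun x hx => by
    simp only [max_eq_right (hcon x hx), Real.zero_rpow hp.ne']] at h1
  simp at h1

lemma IsSol.lapl_nonpos (h : IsSol (ball (0 : EuclideanSpace ℝ (Fin N)) R) p lam α ψ)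
    (x : EuclideanSpace ℝ (Fin N)) (hx : x ∈ ball 0 R) : lapl ψ x ≤ 0 := by
  have h1 : 0 ≤ (max (α + lam * ψ x) 0) ^ p := Real.rpow_nonneg (le_max_right _ _) _
  linarith [h.2.1 x hx]

lemma IsSol.nonneg (hN : 0 < N) (hR : 0 < R)
    (h : IsSol (ball (0 : EuclideanSpace ℝ (Fin N)) R) p lam α ψ)
    {x : EuclideanSpace ℝ (Fin N)} (hx : ‖x‖ ≤ R) : 0 ≤ ψ x := by
  refine le_of_lapl_nonpos hN h.1 (isCompact_closedBall 0 R) (fun y hy => ?_) (x := x)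
    (by simpa using hx)
  rw [mem_closedBall_zero_iff] at hy
  rcases hy.eq_or_lt with hyR | hyR
  · exact Or.inl (h.eq_zero_of_norm_eq hR y hyR).ge
  · have hyR' : y ∈ ball (0 : EuclideanSpace ℝ (Fin N)) R := by simpa using hyR
    exact Or.inr ⟨closedBall_mem_nhds_of_mem hyR', h.lapl_nonpos y hyR'⟩

lemma IsSol.pos (hN : 0 < N) (hR : 0 < R) (hp : 0 < p)
    (h : IsSol (ball (0 : EuclideanSpace ℝ (Fin N)) R) p lam α ψ) :
    ∀ x ∈ ball (0 : EuclideanSpace ℝ (Fin N)) R, 0 < ψ x := by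
  have hnn : ∀ x ∈ ball (0 : EuclideanSpace ℝ (Fin N)) R, 0 ≤ ψ x := fun x hx =>
    h.nonneg hN hR (mem_ball_zero_iff.1 hx).le
  obtain ⟨y, hy, hyp⟩ := h.exists_pos hp
  obtain ⟨z, hz, hzp⟩ : ∃ z ∈ ball (0 : EuclideanSpace ℝ (Fin N)) R, 0 < ψ z := by
    by_contra! hcon
    have hψy : ψ y = 0 := le_antisymm (hcon y hy) (hnn y hy)
    have hmin : IsLocalMin ψ y := by
      filter_upwards [isOpen_ball.mem_nhds hy] with x hx
      rw [hψy]
      exact hnn x hx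
    have h1 := lapl_nonneg_of_isLocalMin h.1 hmin
    have h2 := h.2.1 y hy
    have h3 : 0 < (max (α + lam * ψ y) 0) ^ p :=
      Real.rpow_pos_of_pos (lt_max_of_lt_left hyp) p
    linarith
  exact pos_of_isPreconnected hN h.1 isOpen_ball (convex_ball _ _).isPreconnected
    h.lapl_nonpos hnn hz hzp

lemma IsSol.radial (hN : 0 < N) (hR : 0 < R) (hp : 0 < p) (hlam : 0 ≤ lam)
    (h : IsSol (ball (0 : EuclideanSpace ℝ (Fin N)) R) p lam α ψ)
    (x y : EuclideanSpace ℝ (Fin N)) (hx : ‖x‖ ≤ R) (hxy : ‖x‖ = ‖y‖) : ψ x = ψ y :=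
  radial_of_pos hN hR h.1 (f := fun t => (max (α + lam * t) 0) ^ p)
    (fun s t hst => monotone_max_rpow hp.le (by
      have := mul_le_mul_of_nonneg_left hst hlam
      linarith))
    (fun t => Real.rpow_nonneg (le_max_right _ _) _) h.2.1 (h.pos hN hR hp)
    (h.eq_zero_of_norm_eq hR) hx hxy

lemma IsSol.pos_center (hN : 0 < N) (hR : 0 < R) (hp : 1 < p) (hlam : 0 < lam)
    (h : IsSol (ball (0 : EuclideanSpace ℝ (Fin N)) R) p lam α ψ) : 0 < α + lam * ψ 0 := by
  by_contra! hcon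
  obtain ⟨y, hy, hyp⟩ := h.exists_pos (by linarith)
  have hw : ContDiff ℝ 2 fun x => α + lam * ψ x := contDiff_const.add (contDiff_const.mul h.1)
  have := eq_of_radial_solutions hN hp hlam hw
    (contDiff_const (c := α + lam * ψ 0)) (ρ := R)
    (fun x y hx hxy => by rw [h.radial hN hR (by linarith) hlam.le x y hx hxy])
    (fun _ _ _ _ => rfl) (fun x hx => ?_) (fun x _ => ?_) rfl (mem_ball_zero_iff.1 hy).le
  · linarith
  · rw [lapl_add contDiff_const (contDiff_const.mul h.1), lapl_const, lapl_const_mul h.1]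
    linear_combination lam * h.2.1 x hx
  · rw [lapl_const, max_eq_right hcon, Real.zero_rpow (by linarith)]
    simp

end Threshold

theorem stmt4 (N : ℕ) (hN : 2 ≤ N) (p : ℝ) (hp1 : 1 < p)
    (hpN : N = 2 ∨ p < (N : ℝ) / ((N : ℝ) - 2))
    (u₀ : EuclideanSpace ℝ (Fin N) → ℝ)
    (hu₀ : IsEmden (ball (0 : EuclideanSpace ℝ (Fin N)) 1) p u₀)
    (lam : ℝ) (hlam : 0 ≤ lam) (α : ℝ) (ψ : EuclideanSpace ℝ (Fin N) → ℝ)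
    (hsol : IsSol (DN N) p lam α ψ) :
    0 < α ↔
      lam < (∫ x in ball (0 : EuclideanSpace ℝ (Fin N)) 1, u₀ x ^ p) ^ ((p - 1) / p) *
        RN N ^ (-((N : ℝ) / p) * (1 - p * ((N : ℝ) - 2) / (N : ℝ))) := by
  have hR : 0 < RN N := RN_pos
  have hN0 : 0 < N := by omega
  have hp0 : 0 < p := by linarith
  have hE := exponent_neg hN hp1 hpN
  have hI := hu₀.integral_pos hp0.le
  unfold DN at hsol
  set R := RN N
  set E := -((N : ℝ) / p) * (1 - p * ((N : ℝ) - 2) / (N : ℝ)) with hEdef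
  rcases hlam.eq_or_lt with rfl | hlam
  · obtain ⟨x, -, hx⟩ := hsol.exists_pos hp0
    rw [zero_mul, add_zero] at hx
    exact iff_of_true hx (by positivity)
  have hw0 := hsol.pos_center hN0 hR hp1 hlam
  have hu0 : 0 < u₀ 0 := hu₀.2.2.1 0 (mem_ball_self one_pos)
  obtain ⟨c, hc, hcm⟩ : ∃ c, 0 < c ∧ c * u₀ 0 = α + lam * ψ 0 :=
    ⟨(α + lam * ψ 0) / u₀ 0, by positivity, by field_simp⟩
  obtain ⟨b, hb, hbc⟩ : ∃ b, 0 < b ∧ b ^ 2 = lam * c ^ (p - 1) :=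
    ⟨√(lam * c ^ (p - 1)), by positivity, Real.sq_sqrt (by positivity)⟩
  have hbx : ∀ x : EuclideanSpace ℝ (Fin N), ‖b • x‖ = b * ‖x‖ := fun x => by
    rw [norm_smul, Real.norm_of_nonneg hb.le]
  have hbball : ∀ x ∈ ball (0 : EuclideanSpace ℝ (Fin N)) b⁻¹, b • x ∈ ball 0 1 := by
    intro x hx
    rw [mem_ball_zero_iff] at hx ⊢
    rw [hbx]
    calc b * ‖x‖ < b * b⁻¹ := by gcongr
      _ = 1 := mul_inv_cancel₀ hb.ne'
  have hub : ContDiff ℝ 2 fun x => u₀ (b • x) := hu₀.1.comp (contDiff_const_smul b)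
  have hv : ContDiff ℝ 2 fun x => c * u₀ (b • x) := contDiff_const.mul hub
  have hw : ContDiff ℝ 2 fun x => α + lam * ψ x := contDiff_const.add (contDiff_const.mul hsol.1)
  have hvpos : ∀ x ∈ ball (0 : EuclideanSpace ℝ (Fin N)) b⁻¹, 0 < c * u₀ (b • x) := fun x hx =>
    mul_pos hc (hu₀.2.2.1 _ (hbball x hx))
  have hunique : ∀ x : EuclideanSpace ℝ (Fin N), ‖x‖ ≤ R → ‖x‖ ≤ b⁻¹ →
      α + lam * ψ x = c * u₀ (b • x) := by
    intro x hxR hxb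
    refine eq_of_radial_solutions (ρ := min R b⁻¹) hN0 hp1 hlam hw hv
      (fun x y hx hxy => ?_) (fun x y hx hxy => ?_) (fun x hx => ?_) (fun x hx => ?_) ?_
      (le_min hxR hxb)
    · rw [hsol.radial hN0 hR hp0 hlam.le x y (hx.trans (min_le_left _ _)) hxy]
    · rw [hu₀.radial hN0 hp0.le (b • x) (b • y) ?_ (by rw [hbx, hbx, hxy])]
      rw [hbx]
      calc b * ‖x‖ ≤ b * b⁻¹ := by
            gcongr
            exact hx.trans (min_le_right _ _)
        _ = 1 := mul_inv_cancel₀ hb.ne'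
    · rw [lapl_add contDiff_const (contDiff_const.mul hsol.1), lapl_const, lapl_const_mul hsol.1]
      linear_combination lam * hsol.2.1 x (ball_subset_ball (min_le_left _ _) hx)
    · have hxb := ball_subset_ball (min_le_right _ _) hx
      have hpos := hu₀.2.2.1 _ (hbball x hxb)
      have hcp : c ^ p = c * c ^ (p - 1) := by
        rw [Real.rpow_sub_one hc.ne']
        field_simp
      rw [lapl_const_mul hub, lapl_comp_smul hu₀.1,
        max_eq_left (hvpos x hxb).le, Real.mul_rpow hc.le hpos.le, hcp, hbc]
      linear_combination c * lam * c ^ (p - 1) * hu₀.2.1 _ (hbball x hxb)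
    · simp only [smul_zero, hcm]
  have hwint := hsol.2.2.2
  have hKR : ∀ r, r ≤ R → r ≤ b⁻¹ →
      ∫ x in ball (0 : EuclideanSpace ℝ (Fin N)) r, (c * u₀ (b • x)) ^ p =
        ∫ x in ball (0 : EuclideanSpace ℝ (Fin N)) r, (max (α + lam * ψ x) 0) ^ p := by
    refine fun r hrR hrb => setIntegral_congr_fun measurableSet_ball fun x hx => ?_
    have hx' := (mem_ball_zero_iff.1 hx).le
    simp only [hunique x (hx'.trans hrR) (hx'.trans hrb),
      max_eq_left (hvpos x (ball_subset_ball hrb hx)).le]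
  have hscale := setIntegral_ball_scale (p := p) hb hc hu₀.2.2.1
  set K := ∫ x in ball (0 : EuclideanSpace ℝ (Fin N)) b⁻¹, (c * u₀ (b • x)) ^ p
  have hK : 0 ≤ K := setIntegral_nonneg measurableSet_ball fun x hx =>
    Real.rpow_nonneg (hvpos x hx).le p
  have hval : (∫ x in ball (0 : EuclideanSpace ℝ (Fin N)) 1, u₀ x ^ p) ^ ((p - 1) / p) * R ^ E =
      lam * K ^ ((p - 1) / p) * (b * R) ^ E := by
    rw [hscale, Real.mul_rpow (by positivity) hK,
      rpow_mul_rpow_neg_rpow (by positivity) hp1 hb hc hbc, Real.mul_rpow hb.le hR.le]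
    ring
  rw [hval]
  have hq : 0 ≤ (p - 1) / p := div_nonneg (by linarith) hp0.le
  have hnorm : ∀ r : ℝ, 0 < r → ‖r • EuclideanSpace.single (⟨0, hN0⟩ : Fin N) (1 : ℝ)‖ = r := by
    intro r hr
    rw [norm_smul, PiLp.norm_single, norm_one, mul_one, Real.norm_of_nonneg hr.le]
  rcases lt_or_ge (b * R) 1 with hbR | hbR
  · have hRb : R < b⁻¹ := by rwa [lt_inv_comm₀ hR hb, ← one_div, lt_div_iff₀ hR]
    refine iff_of_true ?_ ?_
    · set x := R • EuclideanSpace.single (⟨0, hN0⟩ : Fin N) (1 : ℝ)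
      have hx : ‖x‖ = R := hnorm R hR
      have h1 := hunique x hx.le (hx.trans_lt hRb).le
      rw [hsol.eq_zero_of_norm_eq hR x hx, mul_zero, add_zero] at h1
      exact h1 ▸ hvpos x (mem_ball_zero_iff.2 (hx.trans_lt hRb))
    · have hK1 : 1 ≤ K := by
        rw [← hwint, ← hKR R le_rfl hRb.le]
        exact setIntegral_mono_set (integrableOn_ball_rpow hv.continuous hp0.le _)
          ((ae_restrict_iff' measurableSet_ball).2 (.of_forall fun x hx =>
            Real.rpow_nonneg (hvpos x hx).le p))
          (ball_subset_ball hRb.le).eventuallyLE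
      have h1 := Real.one_le_rpow hK1 hq
      have h2 := Real.one_lt_rpow_of_pos_of_lt_one_of_neg (by positivity) hbR hE
      calc lam < lam * (b * R) ^ E := lt_mul_of_one_lt_right hlam h2
        _ = lam * 1 * (b * R) ^ E := by rw [mul_one]
        _ ≤ _ := by gcongr
  · have hRb : b⁻¹ ≤ R := by rwa [inv_le_iff_one_le_mul₀ hb, mul_comm]
    refine iff_of_false (not_lt.2 ?_) (not_lt.2 ?_)
    · set x := b⁻¹ • EuclideanSpace.single (⟨0, hN0⟩ : Fin N) (1 : ℝ)
      have hx : ‖x‖ = b⁻¹ := hnorm _ (inv_pos.2 hb)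
      have h1 := hunique x (hx.trans_le hRb) hx.le
      have h2 : u₀ (b • x) = 0 := hu₀.2.2.2 _ (by
        rw [frontier_ball _ one_ne_zero, mem_sphere_zero_iff_norm, hbx, hx,
          mul_inv_cancel₀ hb.ne'])
      have h3 := mul_nonneg hlam.le (hsol.nonneg hN0 hR (hx.trans_le hRb))
      rw [h2, mul_zero] at h1
      linarith
    · have hK1 : K ≤ 1 := by
        rw [← hwint, show K = _ from hKR b⁻¹ hRb le_rfl]
        exact setIntegral_mono_set
          (integrableOn_ball_rpow (hw.continuous.max continuous_const) hp0.le _)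
          (.of_forall fun x => Real.rpow_nonneg (le_max_right _ _) _)
          (ball_subset_ball hRb).eventuallyLE
      have h1 := Real.rpow_le_one hK hK1 hq
      have h2 := Real.rpow_le_one_of_one_le_of_nonpos hbR hE.le
      calc lam * K ^ ((p - 1) / p) * (b * R) ^ E ≤ lam * 1 * 1 := by gcongr
        _ = lam := by ring

end
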